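/- Let $k$ be a field of characteristic $p > 0$, let $R = k[x_1,\dots,x_n]$, let $I = (f_1,\dots,f_s)$ be an ideal of $R$, and let $m$ be a maximal ideal of $R$. If $H^0_m(R/I) = 0$, then $H^0_m(H^s_I(R)) = 0$, where $H^s_I(R)$ is the $s$-th local cohomology module of $R$ with support in $I$ ($s$ being the number of generators of $I$). -/

import Mathlib

/-- The zeroth local cohomology `H⁰_m(M)` of a module `M` with support in an ideal `m`,
i.e. the `m`-torsion submodule `{x ∈ M : mᵗ x = 0 for some t}`. -/
def zerothLocalCohomology {R : Type*} [CommRing R] (m : Ideal R)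
    (M : Type*) [AddCommGroup M] [Module R M] : Submodule R M where
  carrier := {x | ∃ t : ℕ, ∀ r ∈ m ^ t, r • x = 0}
  zero_mem' := ⟨0, fun r _ => smul_zero r⟩
  add_mem' := by
    rintro x y ⟨t₁, h₁⟩ ⟨t₂, h₂⟩
    refine ⟨t₁ + t₂, fun r hr => ?_⟩
    rw [smul_add, h₁ r (Ideal.pow_le_pow_right (by omega) hr),
      h₂ r (Ideal.pow_le_pow_right (by omega) hr), add_zero]
  smul_mem' := by
    rintro c x ⟨t, h⟩
    exact ⟨t, fun r hr => by rw [smul_comm, h r hr, smul_zero]⟩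


section A
open CategoryTheory Limits Opposite
variable {R : Type} [CommRing R]

/-- The map on Hom complexes. -/
noncomputable def lcYonedaMap {X X' : ChainComplex (ModuleCat.{0} R) ℕ} (φ : X ⟶ X') (Y : ModuleCat.{0} R) :
    X'.linearYonedaObj R Y ⟶ X.linearYonedaObj R Y :=
  (HomologicalComplex.unopFunctor _ _).map ((((linearYoneda R (ModuleCat.{0} R)).obj Y).rightOp.mapHomologicalComplex _).map φ).op

lemma lc_homologyUnop_nat {K L : HomologicalComplex (ModuleCat.{0} R)ᵒᵖ (ComplexShape.down ℕ)} (φ : K ⟶ L) (n : ℕ) :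
   HomologicalComplex.homologyMap ((HomologicalComplex.unopFunctor _ _).map φ.op) n ≫ (K.homologyUnop n).hom =
     (L.homologyUnop n).hom ≫ (HomologicalComplex.homologyMap φ n).unop := by
  have := HomologicalComplex.homologyOp_hom_naturality ((HomologicalComplex.unopFunctor _ _).map φ.op) n
  exact (congrArg Quiver.Hom.unop this).symm

lemma lc_gen {C : Type*} [Category C] {A A' B B' D D' : C} (E : A ⟶ A') (i : A ⟶ B) (i' : A' ⟶ B')
    (u : D ≅ B) (u' : D' ≅ B') (H : D ⟶ D') (Hb : B ⟶ B') (h2 : E ≫ i' = i ≫ Hb)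
    (h3 : H ≫ u'.hom = u.hom ≫ Hb) : E ≫ i' ≫ u'.inv = (i ≫ u.inv) ≫ H := by
  rw [← Category.assoc, Iso.comp_inv_eq, Category.assoc, Category.assoc, h3,
    Iso.inv_hom_id_assoc, h2]

lemma lc_isoExt_nat {X X' : ModuleCat.{0} R} (g : X' ⟶ X) (P : ProjectiveResolution X) (P' : ProjectiveResolution X')
    (φ : P'.complex ⟶ P.complex) (comm : φ.f 0 ≫ P.π.f 0 = P'.π.f 0 ≫ g) (n : ℕ) (Y : ModuleCat.{0} R) :
    ((Ext R (ModuleCat.{0} R) n).map g.op).app Y ≫ (P'.isoExt (R := R) n Y).hom =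
     (P.isoExt (R := R) n Y).hom ≫ HomologicalComplex.homologyMap (lcYonedaMap φ Y) n := by
  have h := P'.isoLeftDerivedObj_inv_naturality g P φ comm ((linearYoneda R (ModuleCat.{0} R)).obj Y).rightOp n
  have h2 := congrArg Quiver.Hom.unop h
  have h3 := lc_homologyUnop_nat ((((linearYoneda R (ModuleCat.{0} R)).obj Y).rightOp.mapHomologicalComplex _).map φ) n
  exact lc_gen _ _ _ _ _ _ _ h2 h3
noncomputable def lcCls {X : ModuleCat.{0} R} (P : ProjectiveResolution X) (n : ℕ) (Y : ModuleCat.{0} R) :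
   (P.complex.linearYonedaObj R Y).cycles n ⟶ ((Ext R (ModuleCat.{0} R) n).obj (op X)).obj Y :=
  (P.complex.linearYonedaObj R Y).homologyπ n ≫ (P.isoExt (R := R) n Y).inv

noncomputable def lcCoc {X : ModuleCat.{0} R} (P : ProjectiveResolution X) (n : ℕ) (Y : ModuleCat.{0} R) 
   (z : (P.complex.linearYonedaObj R Y).cycles n) : P.complex.X n ⟶ Y := 
    ((P.complex.linearYonedaObj R Y).iCycles n).hom z

lemma lcCoc_d {X : ModuleCat.{0} R} (P : ProjectiveResolution X) (n : ℕ) (Y : ModuleCat.{0} R) 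
   (z : (P.complex.linearYonedaObj R Y).cycles n) : P.complex.d (n+1) n ≫ lcCoc P n Y z = 0 := by
  have := congrArg (fun k => k.hom z) ((P.complex.linearYonedaObj R Y).iCycles_d n (n+1))
  exact this

lemma lcCls_surj {X : ModuleCat.{0} R} (P : ProjectiveResolution X) (n : ℕ) (Y : ModuleCat.{0} R) :
    Function.Surjective (lcCls P n Y) := by
  rw [← ModuleCat.epi_iff_surjective]
  unfold lcCls
  infer_instance

lemma lcCls_nat {X X' : ModuleCat.{0} R} (g : X' ⟶ X) (P : ProjectiveResolution X) (P' : ProjectiveResolution X')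
    (φ : P'.complex ⟶ P.complex) (comm : φ.f 0 ≫ P.π.f 0 = P'.π.f 0 ≫ g) (n : ℕ) (Y : ModuleCat.{0} R) :
    lcCls P n Y ≫ ((Ext R (ModuleCat.{0} R) n).map g.op).app Y =
      HomologicalComplex.cyclesMap (lcYonedaMap φ Y) n ≫ lcCls P' n Y := by
  have h := lc_isoExt_nat g P P' φ comm n Y
  rw [← Iso.eq_comp_inv] at h
  simp [lcCls, h]

lemma lcCoc_nat {X X' : ModuleCat.{0} R} (P : ProjectiveResolution X) (P' : ProjectiveResolution X')
    (φ : P'.complex ⟶ P.complex) (n : ℕ) (Y : ModuleCat.{0} R) (z) :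
    lcCoc P' n Y ((HomologicalComplex.cyclesMap (lcYonedaMap φ Y) n).hom z) = φ.f n ≫ lcCoc P n Y z := by
  have := congrArg (fun k => k.hom z) (HomologicalComplex.cyclesMap_i (lcYonedaMap φ Y) n)
  exact this

lemma lcCls_eq_zero_succ {X : ModuleCat.{0} R} (P : ProjectiveResolution X) (n : ℕ) (Y : ModuleCat.{0} R)
    (z : (P.complex.linearYonedaObj R Y).cycles (n+1)) : lcCls P (n+1) Y z = 0 ↔
      ∃ b : P.complex.X n ⟶ Y, P.complex.d (n+1) n ≫ b = lcCoc P (n+1) Y z := by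
  have h1 : lcCls P (n+1) Y z = 0 ↔ ((P.complex.linearYonedaObj R Y).homologyπ (n+1)).hom z = 0 := by
    have hinj : Function.Injective (P.isoExt (R := R) (n+1) Y).inv.hom :=
      (ModuleCat.mono_iff_injective _).1 inferInstance
    rw [← map_eq_zero_iff _ hinj]
    rfl
  rw [h1]
  have hex := ShortComplex.exact_of_g_is_cokernel (ShortComplex.mk _ _ ((P.complex.linearYonedaObj R Y).toCycles_comp_homologyπ n (n+1)))
    ((P.complex.linearYonedaObj R Y).homologyIsCokernel n (n+1) (by simp))
  have hi : Function.Injective ((P.complex.linearYonedaObj R Y).iCycles (n+1)).hom :=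
      (ModuleCat.mono_iff_injective _).1 inferInstance
  have hb : ∀ b : P.complex.X n ⟶ Y, ((P.complex.linearYonedaObj R Y).iCycles (n+1)).hom
      (((P.complex.linearYonedaObj R Y).toCycles n (n+1)).hom b) = P.complex.d (n+1) n ≫ b := by
    intro b
    have := congrArg (fun k => k.hom b) ((P.complex.linearYonedaObj R Y).toCycles_i n (n+1))
    exact this
  constructor
  · intro hz
    obtain ⟨b, hb'⟩ := (ShortComplex.moduleCat_exact_iff _).1 hex z hz
    exact ⟨b, (hb b).symm.trans (congrArg _ hb')⟩
  · rintro ⟨b, hb'⟩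
    have : ((P.complex.linearYonedaObj R Y).toCycles n (n+1)).hom b = z := hi ((hb b).trans hb')
    rw [← this]
    have := congrArg (fun k => k.hom b) ((P.complex.linearYonedaObj R Y).toCycles_comp_homologyπ n (n+1))
    exact this

lemma lcCls_eq_zero_zero {X : ModuleCat.{0} R} (P : ProjectiveResolution X) (Y : ModuleCat.{0} R)
    (z : (P.complex.linearYonedaObj R Y).cycles 0) : lcCls P 0 Y z = 0 ↔ lcCoc P 0 Y z = 0 := by
  have hinj : Function.Injective (lcCls P 0 Y).hom := by
    rw [← ModuleCat.mono_iff_injective]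
    unfold lcCls
    infer_instance
  have hi : Function.Injective ((P.complex.linearYonedaObj R Y).iCycles 0).hom :=
      (ModuleCat.mono_iff_injective _).1 inferInstance
  exact (map_eq_zero_iff _ hinj).trans (map_eq_zero_iff _ hi).symm

open CochainComplex HomComplex

lemma lcP_zero {X Y : ModuleCat.{0} R} (P : ProjectiveResolution X) (f : P.complex.X 0 ⟶ Y)
    (hf : P.complex.d 1 0 ≫ f = 0) : P.extMk f 1 rfl hf = 0 ↔ f = 0 := by
  refine ⟨fun h => ?_, fun h => by subst h; simp⟩
  simp only [← P.extEquivCohomologyClass.apply_eq_iff_eq,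
    ProjectiveResolution.extEquivCohomologyClass_extMk, ProjectiveResolution.extEquivCohomologyClass_zero,
    CohomologyClass.mk_eq_zero_iff] at h
  rw [Cocycle.toSingleMk_mem_coboundaries_iff _ _ _ _ _ 1 (by simp)] at h
  obtain ⟨g, hg⟩ := h
  have hz : IsZero (P.cochainComplex.X 1) := by
    exact CochainComplex.isZero_of_isStrictlyLE _ 0 1 (by simp)
  rw [hz.eq_of_src g 0, comp_zero] at hg
  rw [← cancel_epi (P.cochainComplexXIso (-(0:ℕ)) 0 rfl).hom, ← hg, comp_zero]

lemma lcI_zero {X Y : ModuleCat.{0} R} (P : InjectiveResolution Y) (f : X ⟶ P.cocomplex.X 0)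
    (hf : f ≫ P.cocomplex.d 0 1 = 0) : P.extMk f 1 rfl hf = 0 ↔ f = 0 := by
  refine ⟨fun h => ?_, fun h => by subst h; simp⟩
  simp only [← P.extEquivCohomologyClass.apply_eq_iff_eq,
    InjectiveResolution.extEquivCohomologyClass_extMk, InjectiveResolution.extEquivCohomologyClass_zero,
    CohomologyClass.mk_eq_zero_iff] at h
  rw [Cocycle.fromSingleMk_mem_coboundaries_iff _ _ _ _ _ (-1) (by simp)] at h
  obtain ⟨g, hg⟩ := h
  have hz : IsZero (P.cochainComplex.X (-1)) := by
    exact CochainComplex.isZero_of_isStrictlyGE _ 0 (-1) (by simp)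
  rw [hz.eq_of_tgt g 0, zero_comp] at hg
  rw [← cancel_mono (P.cochainComplexXIso (0:ℕ) 0 rfl).inv, ← hg, zero_comp]

lemma lcCls_eq_zero_iff {X Y : ModuleCat.{0} R} (P : ProjectiveResolution X) (n : ℕ)
    (z : (P.complex.linearYonedaObj R Y).cycles n) :
    lcCls P n Y z = 0 ↔ P.extMk (lcCoc P n Y z) (n+1) rfl (lcCoc_d P n Y z) = 0 := by
  cases n with
  | zero => rw [lcP_zero, lcCls_eq_zero_zero]
  | succ n => rw [P.extMk_eq_zero_iff _ _ _ _ n rfl, lcCls_eq_zero_succ]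

/-- The class `e` corresponds to the cocycle `h` valued in an injective resolution. -/
def lcRel {X Y : ModuleCat.{0} R} (E : InjectiveResolution Y) (n : ℕ)
    (e : ((Ext R (ModuleCat.{0} R) n).obj (op X)).obj Y) (h : X ⟶ E.cocomplex.X n) : Prop :=
  ∃ (hh : h ≫ E.cocomplex.d n (n+1) = 0) (P : ProjectiveResolution X)
    (z : (P.complex.linearYonedaObj R Y).cycles n), lcCls P n Y z = e ∧
      P.extMk (lcCoc P n Y z) (n+1) rfl (lcCoc_d P n Y z) = E.extMk h (n+1) rfl hh

lemma lcRel_exists {X Y : ModuleCat.{0} R} (E : InjectiveResolution Y) (n : ℕ)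
    (e : ((Ext R (ModuleCat.{0} R) n).obj (op X)).obj Y) : ∃ h, lcRel E n e h := by
  let P := projectiveResolution X
  obtain ⟨z, hz⟩ := lcCls_surj P n Y e
  obtain ⟨h, hh, hh'⟩ := E.extMk_surjective (P.extMk (lcCoc P n Y z) (n+1) rfl (lcCoc_d P n Y z)) (n+1) rfl
  exact ⟨h, hh, P, z, hz, hh'.symm⟩

lemma lcRel_zero_iff {X Y : ModuleCat.{0} R} (E : InjectiveResolution Y) (n : ℕ)
    (e : ((Ext R (ModuleCat.{0} R) n).obj (op X)).obj Y) (h : X ⟶ E.cocomplex.X n)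
    (H : lcRel E n e h) : e = 0 ↔ E.extMk h (n+1) rfl H.choose = 0 := by
  obtain ⟨hh, P, z, rfl, h2⟩ := H
  rw [← h2, lcCls_eq_zero_iff]

lemma lcRel_nat {X X' Y : ModuleCat.{0} R} (g : X' ⟶ X) (E : InjectiveResolution Y) (n : ℕ)
    (e : ((Ext R (ModuleCat.{0} R) n).obj (op X)).obj Y) (h : X ⟶ E.cocomplex.X n)
    (H : lcRel E n e h) : lcRel E n (((((Ext R (ModuleCat.{0} R) n).map g.op).app Y).hom e)) (g ≫ h) := by
  obtain ⟨hh, P, z, rfl, h2⟩ := H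
  let P' := projectiveResolution X'
  let φ := ProjectiveResolution.lift g P' P
  have comm : φ.f 0 ≫ P.π.f 0 = P'.π.f 0 ≫ g := ProjectiveResolution.lift_commutes_zero g P' P
  let Φ : ProjectiveResolution.Hom P' P g := ⟨φ, by rw [comm]; simp⟩
  refine ⟨by rw [Category.assoc, hh, comp_zero], P', (HomologicalComplex.cyclesMap (lcYonedaMap φ Y) n).hom z, ?_, ?_⟩
  · exact (congrArg (fun k => k.hom z) (lcCls_nat g P P' φ comm n Y)).symm
  · have h3 := P.mk₀_comp_extMk (lcCoc P n Y z) (n+1) rfl (lcCoc_d P n Y z) Φ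
    rw [h2, E.mk₀_comp_extMk] at h3
    rw [h3]
    congr 1
    exact lcCoc_nat P P' φ n Y z

lemma lcRel_smul {X Y : ModuleCat.{0} R} (r : R) (E : InjectiveResolution Y) (n : ℕ)
    (e : ((Ext R (ModuleCat.{0} R) n).obj (op X)).obj Y) (h : X ⟶ E.cocomplex.X n)
    (H : lcRel E n e h) : lcRel E n (r • e) (r • h) := by
  obtain ⟨hh, P, z, rfl, h2⟩ := H
  let φ : P.complex ⟶ P.complex := r • 𝟙 P.complex
  let Φ : ProjectiveResolution.Hom P P (r • 𝟙 X) := ⟨φ,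
    (Linear.smul_comp (R := R) _ _ _ r (𝟙 (P.complex.X 0)) (P.π.f 0)).trans (by
      rw [Category.id_comp]
      exact ((Linear.comp_smul (R := R) _ _ _ (P.π.f 0) r (𝟙 X)).trans (congrArg (fun q => r • q) (Category.comp_id _))).symm)⟩
  refine ⟨by rw [Linear.smul_comp, hh, smul_zero], P, r • z, ?_, ?_⟩
  · exact map_smul (lcCls P n Y).hom r z
  · have h3 := P.mk₀_comp_extMk (lcCoc P n Y z) (n+1) rfl (lcCoc_d P n Y z) Φ
    rw [h2, E.mk₀_comp_extMk] at h3
    have e1 : lcCoc P n Y (r • z) = Φ.hom.f n ≫ lcCoc P n Y z := by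
      have : lcCoc P n Y (r • z) = r • lcCoc P n Y z := 
        map_smul ((P.complex.linearYonedaObj R Y).iCycles n).hom r z
      rw [this]
      simp [Φ, φ]
    have e2 : r • h = (r • 𝟙 X) ≫ h := by simp
    simp only [e1, e2]
    exact h3.symm

lemma lc_colim (I : Ideal R) (s : ℕ) (Y : ModuleCat.{0} R) :
    Nonempty (IsColimit (((evaluation _ _).obj Y).mapCocone
      (colimit.cocone (localCohomology.diagram (localCohomology.idealPowersDiagram I) s)))) :=
  ⟨isColimitOfPreserves _ (colimit.isColimit _)⟩

/-- The canonical map. -/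
noncomputable def lcIota (I : Ideal R) (s t : ℕ) (Y : ModuleCat.{0} R) :
    ((Ext R (ModuleCat.{0} R) s).obj (op (ModuleCat.of R (R ⧸ I ^ t)))).obj Y ⟶ (localCohomology I s).obj Y :=
  (colimit.ι (localCohomology.diagram (localCohomology.idealPowersDiagram I) s) (op (op t))).app Y

/-- The projection. -/
noncomputable def lcProj (I : Ideal R) {t t' : ℕ} (h : t ≤ t') :
    ModuleCat.of R (R ⧸ I ^ t') ⟶ ModuleCat.of R (R ⧸ I ^ t) :=
  ModuleCat.ofHom <| Submodule.mapQ _ _ LinearMap.id (Ideal.pow_le_pow_right h)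

lemma lcIota_rep (I : Ideal R) (s : ℕ) (Y : ModuleCat.{0} R) (ξ : (localCohomology I s).obj Y) :
    ∃ t e, (lcIota I s t Y).hom e = ξ := by
  obtain ⟨hc⟩ := lc_colim I s Y
  obtain ⟨t, e, h⟩ := Concrete.isColimit_exists_rep _ hc ξ
  exact ⟨t.unop.unop, e, h⟩

lemma lcIota_proj (I : Ideal R) (s : ℕ) (Y : ModuleCat.{0} R) {t t' : ℕ} (h : t ≤ t') (e) :
    (lcIota I s t' Y).hom ((((Ext R (ModuleCat.{0} R) s).map (lcProj I h).op).app Y).hom e) =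
    (lcIota I s t Y).hom e := by
  have := colimit.w (localCohomology.diagram (localCohomology.idealPowersDiagram I) s)
    ((homOfLE h).op.op)
  exact congrArg (fun k => (k.app Y).hom e) this

lemma lcIota_zero (I : Ideal R) (s : ℕ) (Y : ModuleCat.{0} R) {t : ℕ} (e)
    (he : (lcIota I s t Y).hom e = 0) : ∃ t', ∃ h : t ≤ t', 
      (((Ext R (ModuleCat.{0} R) s).map (lcProj I h).op).app Y).hom e = 0 := by
  obtain ⟨hc⟩ := lc_colim I s Y
  have he' : (lcIota I s t Y).hom e = (lcIota I s t Y).hom 0 := by rw [he, map_zero]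
  obtain ⟨t', f, g, h⟩ := Concrete.isColimit_exists_of_rep_eq _ hc (i := op (op t)) (j := op (op t)) e 0 he'
  refine ⟨t'.unop.unop, leOfHom f.unop.unop, ?_⟩
  exact h.trans (map_zero (((localCohomology.diagram (localCohomology.idealPowersDiagram I) s).map g).app Y).hom)

theorem lcA (I : Ideal R) (s : ℕ) (Y : ModuleCat.{0} R) (E : InjectiveResolution Y)
    (ξ : (localCohomology I s).obj Y) : ∃ x : E.cocomplex.X s,
      (E.cocomplex.d s (s+1)).hom x = 0 ∧ (∃ t : ℕ, ∀ r ∈ I ^ t, r • x = 0) ∧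
      ∀ r : R, r • ξ = 0 ↔ (r • x = 0 ∨ ∃ i, i + 1 = s ∧ ∃ y : E.cocomplex.X i,
        (∃ t : ℕ, ∀ r ∈ I ^ t, r • y = 0) ∧ (E.cocomplex.d i s).hom y = r • x) := by
  obtain ⟨t, e, rfl⟩ := lcIota_rep I s Y ξ
  obtain ⟨h, H⟩ := lcRel_exists E s e
  have kill : ∀ {t' : ℕ} {i : ℕ} (b : ModuleCat.of R (R ⧸ I ^ t') ⟶ E.cocomplex.X i),
      ∀ r ∈ I ^ t', r • b.hom (Submodule.Quotient.mk (1 : R)) = 0 := by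
    intro t' i b r hr
    rw [← map_smul]
    have : r • (Submodule.Quotient.mk (1 : R) : R ⧸ I ^ t') = 0 := by
      rw [← Submodule.Quotient.mk_smul, Submodule.Quotient.mk_eq_zero]
      simpa using hr
    exact (congrArg _ this).trans (map_zero _)
  have mk : ∀ {t' : ℕ} {i : ℕ} (y : E.cocomplex.X i) (hy : ∀ r ∈ I ^ t', r • y = 0),
      ∃ b : ModuleCat.of R (R ⧸ I ^ t') ⟶ E.cocomplex.X i, b.hom (Submodule.Quotient.mk (1 : R)) = y := by
    intro t' i y hy
    refine ⟨ModuleCat.ofHom (Submodule.liftQ _ (LinearMap.toSpanSingleton R _ y) ?_), ?_⟩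
    · intro r hr
      exact hy r hr
    · exact one_smul R y
  have hext : ∀ {t' : ℕ} {i : ℕ} (b b' : ModuleCat.of R (R ⧸ I ^ t') ⟶ E.cocomplex.X i),
      b.hom (Submodule.Quotient.mk (1 : R)) = b'.hom (Submodule.Quotient.mk (1 : R)) → b = b' := by
    intro t' i b b' hb
    ext
    exact hb
  refine ⟨h.hom (Submodule.Quotient.mk (1 : R)), ?_, ⟨t, kill h⟩, ?_⟩
  · exact congrArg (fun k => k.hom (Submodule.Quotient.mk (1 : R))) H.choose
  intro r
  have key : r • (lcIota I s t Y).hom e = 0 ↔ ∃ t', ∃ h : t ≤ t',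
      (((Ext R (ModuleCat.{0} R) s).map (lcProj I h).op).app Y).hom (r • e) = 0 := by
    rw [← map_smul]
    constructor
    · exact lcIota_zero I s Y (r • e)
    · rintro ⟨t', h, h'⟩
      rw [← lcIota_proj I s Y h, h', map_zero]
  rw [key]
  have key2 : ∀ t' (ht : t ≤ t'), (((Ext R (ModuleCat.{0} R) s).map (lcProj I ht).op).app Y).hom (r • e) = 0 ↔
     (r • h.hom (Submodule.Quotient.mk (1 : R)) = 0 ∨ ∃ i, i + 1 = s ∧ ∃ y : E.cocomplex.X i,
        (∀ r ∈ I ^ t', r • y = 0) ∧ (E.cocomplex.d i s).hom y = r • h.hom (Submodule.Quotient.mk (1 : R))) := by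
    intro t' ht
    have H2 := lcRel_nat (lcProj I ht) E s _ _ (lcRel_smul r E s e h H)
    rw [lcRel_zero_iff _ _ _ _ H2]
    have hx : (lcProj I ht ≫ (r • h)).hom (Submodule.Quotient.mk (1 : R)) = r • h.hom (Submodule.Quotient.mk (1 : R)) := rfl
    cases s with
    | zero =>
      rw [lcI_zero]
      rw [← hx]
      constructor
      · intro h0
        left
        rw [h0]
        rfl
      · rintro (h0 | ⟨i, hi, -⟩)
        · exact hext _ 0 h0
        · omega
    | succ s =>
      rw [E.extMk_eq_zero_iff _ _ _ _ s rfl, ← hx]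
      constructor
      · rintro ⟨b, hb⟩
        exact Or.inr ⟨s, rfl, b.hom (Submodule.Quotient.mk (1 : R)), kill b, congrArg (fun k => k.hom (Submodule.Quotient.mk (1 : R))) hb⟩
      · rintro (h0 | ⟨i, hi, y, hy, hy'⟩)
        · refine ⟨0, ?_⟩
          rw [zero_comp]
          exact (hext _ 0 h0).symm
        · obtain rfl : i = s := by omega
          obtain ⟨b, hb⟩ := mk y hy
          refine ⟨b, hext _ _ ?_⟩
          rw [← hy', ← hb]
          rfl
  constructor
  · rintro ⟨t', ht, h'⟩
    rcases (key2 t' ht).1 h' with h0 | ⟨i, hi, y, hy, hy'⟩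
    · exact Or.inl h0
    · exact Or.inr ⟨i, hi, y, ⟨t', hy⟩, hy'⟩
  · rintro (h0 | ⟨i, hi, y, ⟨t', hy⟩, hy'⟩)
    · exact ⟨t, le_rfl, (key2 t le_rfl).2 (Or.inl h0)⟩
    · refine ⟨max t t', le_max_left _ _, (key2 _ _).2 (Or.inr ⟨i, hi, y, ?_, hy'⟩)⟩
      exact fun r hr => hy r (Ideal.pow_le_pow_right (le_max_right _ _) hr)

end A

section B
set_option linter.unusedSectionVars false

/-- An (abstract) injective resolution of the ring `R`. -/
structure LCRes (R : Type) [CommRing R] where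
  E : ℕ → Type
  [grp : ∀ i, AddCommGroup (E i)]
  [mod : ∀ i, Module R (E i)]
  d : ∀ i, E i →ₗ[R] E (i+1)
  ι : R →ₗ[R] E 0
  ι_inj : ∀ m, ι m = 0 → m = 0
  d_ι : ∀ m, d 0 (ι m) = 0
  d_d : ∀ i x, d (i+1) (d i x) = 0
  exact_zero : ∀ x, d 0 x = 0 → ∃ m, ι m = x
  exact_succ : ∀ i x, d (i+1) x = 0 → ∃ y, d i y = x
  baer : ∀ i, Module.Baer R (E i)

attribute [instance] LCRes.grp LCRes.mod

variable {R : Type} [CommRing R]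

lemma lc_mem_tors {M : Type} [AddCommGroup M] [Module R M] {J : Ideal R} {x : M} :
    x ∈ zerothLocalCohomology J M ↔ ∃ t : ℕ, ∀ r ∈ J ^ t, r • x = 0 := Iff.rfl

lemma lc_tors_cons {M : Type} [AddCommGroup M] [Module R M] {fs : List R} {g : R} {x : M} :
    x ∈ zerothLocalCohomology (Ideal.ofList (g :: fs)) M ↔
      x ∈ zerothLocalCohomology (Ideal.ofList fs) M ∧ ∃ t : ℕ, g ^ t • x = 0 := by
  rw [Ideal.ofList_cons]
  constructor
  · rintro ⟨t, ht⟩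
    refine ⟨⟨t, fun r hr => ht r (Ideal.pow_right_mono le_sup_right t hr)⟩, t, ht _ ?_⟩
    exact Ideal.pow_mem_pow (Ideal.mem_sup_left (Ideal.mem_span_singleton_self g)) t
  · rintro ⟨⟨t, ht⟩, u, hu⟩
    refine ⟨u + t, fun r hr => ?_⟩
    have := Ideal.sup_pow_add_le_pow_sup_pow hr
    obtain ⟨a, ha, b, hb, rfl⟩ := Submodule.mem_sup.1 this
    rw [Ideal.span_singleton_pow, Ideal.mem_span_singleton'] at ha
    obtain ⟨c, rfl⟩ := ha
    rw [add_smul, ht b hb, mul_smul, hu, smul_zero, add_zero]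

lemma lc_tors_map {M M' : Type} [AddCommGroup M] [Module R M] [AddCommGroup M'] [Module R M']
    (f : M →ₗ[R] M') {J : Ideal R} {x : M} (hx : x ∈ zerothLocalCohomology J M) :
    f x ∈ zerothLocalCohomology J M' := by
  obtain ⟨t, ht⟩ := hx
  exact ⟨t, fun r hr => by rw [← map_smul, ht r hr, map_zero]⟩

lemma lc_artin_rees [IsDomain R] [IsNoetherianRing R] (J : Ideal R) (g : R) (hg : g ≠ 0) (N : ℕ) :
    ∃ L, ∀ r, g * r ∈ J ^ L → r ∈ J ^ N := by
  obtain ⟨k, hk⟩ := Ideal.exists_pow_inf_eq_pow_smul J (Ideal.span {g} : Submodule R R)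
  refine ⟨k + N, fun r hr => ?_⟩
  have h1 : g * r ∈ (J ^ (k + N) • ⊤ ⊓ (Ideal.span {g} : Submodule R R) : Submodule R R) := by
    refine ⟨?_, Ideal.mem_span_singleton.2 (dvd_mul_right _ _)⟩
    simpa using hr
  rw [hk (k + N) (by omega), Nat.add_sub_cancel_left] at h1
  have h2 : g * r ∈ J ^ N • (Ideal.span {g} : Submodule R R) :=
    Submodule.smul_mono le_rfl inf_le_right h1
  have h3 : g * r ∈ J ^ N * Ideal.span {g} := h2
  rw [Ideal.mem_mul_span_singleton] at h3
  obtain ⟨z, hz, hz'⟩ := h3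
  rw [mul_comm] at hz'
  rwa [← mul_left_cancel₀ hg hz']

lemma lc_div [IsDomain R] [IsNoetherianRing R] {M : Type} [AddCommGroup M] [Module R M]
    (hM : Module.Baer R M) (J : Ideal R) (g : R) (hg : g ≠ 0) (x : M)
    (hx : x ∈ zerothLocalCohomology J M) : ∃ y ∈ zerothLocalCohomology J M, g • y = x := by
  obtain ⟨N, hN⟩ := hx
  obtain ⟨L, hL⟩ := lc_artin_rees J g hg N
  -- the map R × J^L → span{g} ⊔ J^L
  let K : Ideal R := Ideal.span {g} ⊔ J ^ L
  have hK : ∀ a : K, ∃ r : R, (a : R) - g * r ∈ J ^ L := by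
    rintro ⟨a, ha⟩
    obtain ⟨b, hb, c, hc, rfl⟩ := Submodule.mem_sup.1 ha
    obtain ⟨r, rfl⟩ := Ideal.mem_span_singleton'.1 hb
    refine ⟨r, ?_⟩
    have : r * g + c - g * r = c := by ring
    simpa [this] using hc
  choose ρ hρ using hK
  have key : ∀ (a : K) (r : R), (a : R) - g * r ∈ J ^ L → ρ a • x = r • x := by
    intro a r hr
    rw [← sub_eq_zero, ← sub_smul]
    apply hN
    apply hL
    have : g * (ρ a - r) = ((a : R) - g * r) - ((a : R) - g * ρ a) := by ring
    rw [this]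
    exact sub_mem hr (hρ a)
  let φ : K →ₗ[R] M :=
    { toFun := fun a => ρ a • x
      map_add' := by
        intro a b
        rw [key (a + b) (ρ a + ρ b), add_smul]
        have : ((a + b : K) : R) - g * (ρ a + ρ b) = ((a : R) - g * ρ a) + ((b : R) - g * ρ b) := by
          push_cast; ring
        rw [this]
        exact add_mem (hρ a) (hρ b)
      map_smul' := by
        intro c a
        rw [key (c • a) (c * ρ a), mul_smul]
        · rfl
        have : ((c • a : K) : R) - g * (c * ρ a) = c * ((a : R) - g * ρ a) := by
          simp only [SetLike.val_smul, smul_eq_mul]; ring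
        rw [this]
        exact Ideal.mul_mem_left _ _ (hρ a) }
  obtain ⟨ψ, hψ⟩ := hM K φ
  have hψ' : ∀ r, ψ r = r • ψ 1 := fun r => by rw [← map_smul]; simp
  refine ⟨ψ 1, ⟨L, fun r hr => ?_⟩, ?_⟩
  · rw [← hψ', hψ r (Ideal.mem_sup_right hr)]
    refine (key _ 0 ?_).trans (zero_smul _ _)
    simpa using hr
  · rw [← hψ', hψ g (Ideal.mem_sup_left (Ideal.mem_span_singleton_self g))]
    refine (key _ 1 ?_).trans (one_smul _ _)
    simp

namespace LCRes
variable (C : LCRes R)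

/-- torsion -/
abbrev T (J : Ideal R) (i : ℕ) : Submodule R (C.E i) := zerothLocalCohomology J (C.E i)

/-- boundaries -/
def B (J : Ideal R) : ∀ i, Submodule R (C.E i)
  | 0 => ⊥
  | i+1 => (C.T J i).map (C.d i)

lemma mem_B_succ {J : Ideal R} {i : ℕ} {x : C.E (i+1)} :
    x ∈ C.B J (i+1) ↔ ∃ y ∈ C.T J i, C.d i y = x := Iff.rfl

lemma B_le_T (J : Ideal R) (i : ℕ) : C.B J i ≤ C.T J i := by
  cases i with
  | zero => exact bot_le
  | succ i =>
    rintro x ⟨y, hy, rfl⟩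
    exact lc_tors_map _ hy

lemma d_B {J : Ideal R} {i : ℕ} {x : C.E i} (hx : x ∈ C.B J i) : C.d i x = 0 := by
  cases i with
  | zero => rw [(Submodule.mem_bot R).1 hx, map_zero]
  | succ i =>
    obtain ⟨y, hy, rfl⟩ := hx
    exact C.d_d _ _

variable [IsDomain R] [IsNoetherianRing R]

lemma div_B {J : Ideal R} {i : ℕ} {x : C.E i} (hx : x ∈ C.B J i) {g : R} (hg : g ≠ 0) (t : ℕ) :
    ∃ y ∈ C.B J i, g ^ t • y = x := by
  cases i with
  | zero => exact ⟨0, zero_mem _, by rw [(Submodule.mem_bot R).1 hx, smul_zero]⟩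
  | succ i =>
    obtain ⟨y, hy, rfl⟩ := hx
    obtain ⟨z, hz, hz'⟩ := lc_div (C.baer i) J (g ^ t) (pow_ne_zero _ hg) y hy
    exact ⟨C.d i z, ⟨z, hz, rfl⟩, by rw [← map_smul, hz']⟩

lemma van (fs : List R) : ∀ i, fs.length < i → ∀ x ∈ C.T (Ideal.ofList fs) i, C.d i x = 0 →
    x ∈ C.B (Ideal.ofList fs) i := by
  induction fs with
  | nil =>
    intro i hi x _ hx'
    obtain ⟨i, rfl⟩ : ∃ j, i = j + 1 := ⟨i - 1, by simp at hi; omega⟩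
    obtain ⟨y, hy⟩ := C.exact_succ i x hx'
    exact ⟨y, ⟨1, fun r hr => by simp at hr; rw [hr, zero_smul]⟩, hy⟩
  | cons g fs ih =>
    intro i hi x hx hx'
    simp only [List.length_cons] at hi
    obtain ⟨i, rfl⟩ : ∃ j, i = j + 1 := ⟨i - 1, by omega⟩
    obtain ⟨hx1, t, ht⟩ := lc_tors_cons.1 hx
    obtain ⟨y, hy, hy'⟩ := ih _ (by omega) x hx1 hx'
    by_cases hg : g = 0
    · exact ⟨y, lc_tors_cons.2 ⟨hy, 1, by simp [hg]⟩, hy'⟩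
    have h1 : g ^ t • y ∈ C.B (Ideal.ofList fs) i := by
      apply ih i (by omega) _ (Submodule.smul_mem _ _ hy)
      rw [map_smul, hy', ht]
    obtain ⟨z, hz, hz'⟩ := C.div_B h1 hg t
    refine ⟨y - z, lc_tors_cons.2 ⟨sub_mem hy (C.B_le_T _ _ hz), t, ?_⟩, ?_⟩
    · rw [smul_sub, hz', sub_self]
    · rw [map_sub, C.d_B hz, hy', sub_zero]

/-- `C.P t fs m x` says that `x` represents the class `m / f^t`. -/
def P (t : ℕ) : (fs : List R) → R → C.E fs.length → Prop
  | [], m, x => x = C.ι m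
  | g :: fs, m, x => ∃ y ∈ C.T (Ideal.ofList fs) fs.length, C.d _ y = x ∧ P t fs m (g ^ t • y)

lemma P_sub {t : ℕ} : ∀ {fs : List R} {m m' : R} {x x' : C.E fs.length},
    C.P t fs m x → C.P t fs m' x' → C.P t fs (m - m') (x - x') := by
  intro fs
  induction fs with
  | nil =>
    intro m m' x x' h h'
    simp only [P] at *
    rw [h, h', map_sub]
  | cons g fs ih =>
    rintro m m' x x' ⟨y, hy, hyx, h⟩ ⟨y', hy', hyx', h'⟩
    refine ⟨y - y', sub_mem hy hy', by rw [map_sub, hyx, hyx'], ?_⟩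
    rw [smul_sub]
    exact ih h h'

lemma P_smul {t : ℕ} (r : R) : ∀ {fs : List R} {m : R} {x : C.E fs.length},
    C.P t fs m x → C.P t fs (r * m) (r • x) := by
  intro fs
  induction fs with
  | nil =>
    intro m x h
    simp only [P] at *
    rw [h, ← map_smul, smul_eq_mul]
  | cons g fs ih =>
    rintro m x ⟨y, hy, hyx, h⟩
    refine ⟨r • y, Submodule.smul_mem _ _ hy, by rw [map_smul, hyx], ?_⟩
    rw [smul_comm]
    exact ih h

lemma P_mem {t : ℕ} : ∀ {fs : List R} {m : R} {x : C.E fs.length},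
    C.P t fs m x → x ∈ C.T (Ideal.ofList fs) fs.length ∧ C.d _ x = 0 := by
  intro fs
  induction fs with
  | nil =>
    intro m x h
    simp only [P] at h
    subst h
    exact ⟨⟨1, fun r hr => by simp at hr; rw [hr, zero_smul]⟩, C.d_ι m⟩
  | cons g fs ih =>
    rintro m x ⟨y, hy, rfl, h⟩
    refine ⟨lc_tors_cons.2 ⟨lc_tors_map _ hy, t, ?_⟩, C.d_d _ _⟩
    rw [← map_smul]
    exact (ih h).2

lemma P_compat {t : ℕ} (w : ℕ) : ∀ {fs : List R} {m : R} {x : C.E fs.length},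
    C.P t fs m x → C.P (t + w) fs (fs.prod ^ w * m) x := by
  intro fs
  induction fs with
  | nil =>
    intro m x h
    simpa [P] using h
  | cons g fs ih =>
    rintro m x ⟨y, hy, hyx, h⟩
    refine ⟨y, hy, hyx, ?_⟩
    have := C.P_smul (g ^ w) (ih h)
    rw [smul_smul, ← pow_add, add_comm w t] at this
    rw [List.prod_cons, mul_pow, mul_assoc]
    exact this

lemma P_compat' {t t' : ℕ} (h : t ≤ t') {fs : List R} {m : R} {x : C.E fs.length}
    (H : C.P t fs m x) : C.P t' fs (fs.prod ^ (t' - t) * m) x := by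
  have := C.P_compat (t' - t) H
  rwa [Nat.add_sub_cancel' h] at this

lemma P_tot (t : ℕ) : ∀ {fs : List R} (_ : ∀ f ∈ fs, f ≠ 0) (m : R), ∃ x, C.P t fs m x := by
  intro fs
  induction fs with
  | nil =>
    intro _ m
    exact ⟨C.ι m, rfl⟩
  | cons g fs ih =>
    intro hfs m
    obtain ⟨x, hx⟩ := ih (fun f hf => hfs f (List.mem_cons_of_mem _ hf)) m
    obtain ⟨y, hy, hy'⟩ := lc_div (C.baer _) _ (g ^ t) (pow_ne_zero _ (hfs g List.mem_cons_self)) x (C.P_mem hx).1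
    exact ⟨C.d _ y, y, hy, rfl, by rwa [hy']⟩

lemma P_surj : ∀ {fs : List R} (x : C.E fs.length), x ∈ C.T (Ideal.ofList fs) fs.length →
    C.d _ x = 0 → ∃ t m, C.P t fs m x := by
  intro fs
  induction fs with
  | nil =>
    intro x _ hx
    obtain ⟨m, hm⟩ := C.exact_zero x hx
    exact ⟨0, m, hm.symm⟩
  | cons g fs ih =>
    intro x hx hx'
    obtain ⟨hx1, u, hu⟩ := lc_tors_cons.1 hx
    obtain ⟨y, hy, hyx⟩ := C.van fs _ (Nat.lt_succ_self _) x hx1 hx'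
    obtain ⟨t, m, h⟩ := ih (g ^ u • y) (Submodule.smul_mem _ _ hy) (by rw [map_smul, hyx]; exact hu)
    have h2 := C.P_smul (g ^ t) (C.P_compat u h)
    refine ⟨t + u, g ^ t * (fs.prod ^ u * m), y, hy, hyx, ?_⟩
    rw [smul_smul, ← pow_add] at h2
    exact h2

lemma pow_mono {t : ℕ} (w : ℕ) : ∀ {fs : List R} {a : R}, a ∈ Ideal.ofList (fs.map (· ^ t)) →
    fs.prod ^ w * a ∈ Ideal.ofList (fs.map (· ^ (t + w))) := by
  intro fs
  induction fs with
  | nil =>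
    intro a ha
    simp at ha
    simp [ha]
  | cons g fs ih =>
    intro a ha
    rw [List.map_cons, Ideal.ofList_cons] at ha ⊢
    obtain ⟨b, hb, c, hc, rfl⟩ := Submodule.mem_sup.1 ha
    obtain ⟨r, rfl⟩ := Ideal.mem_span_singleton'.1 hb
    rw [mul_add]
    refine add_mem (Ideal.mem_sup_left ?_) (Ideal.mem_sup_right ?_)
    · rw [Ideal.mem_span_singleton]
      refine ⟨fs.prod ^ w * r, ?_⟩
      rw [List.prod_cons]; ring
    · have : (g :: fs).prod ^ w * c = g ^ w * (fs.prod ^ w * c) := by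
        rw [List.prod_cons]; ring
      rw [this]
      exact Ideal.mul_mem_left _ _ (ih hc)

lemma P_ker : ∀ {fs : List R} {t : ℕ} {m : R} {x : C.E fs.length}, C.P t fs m x →
    x ∈ C.B (Ideal.ofList fs) fs.length → ∃ u, fs.prod ^ u * m ∈ Ideal.ofList (fs.map (· ^ (t + u))) := by
  intro fs
  induction fs with
  | nil =>
    intro t m x h hx
    have h1 : x = C.ι m := h
    have h2 : x = 0 := hx
    rw [h2] at h1
    rw [C.ι_inj m h1.symm]
    exact ⟨0, by simp⟩
  | cons g fs ih =>
    rintro t m x ⟨y, hy, rfl, h⟩ ⟨v, hv, hvy⟩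
    obtain ⟨hv1, u, hu⟩ := lc_tors_cons.1 hv
    obtain ⟨t', m', h'⟩ := C.P_surj (y - v) (sub_mem hy hv1) (by rw [map_sub, sub_eq_zero]; exact hvy.symm)
    have e1 := C.P_smul (g ^ u) (C.P_compat t' h)
    have e2 := C.P_smul (g ^ (t + u)) (C.P_compat t h')
    rw [add_comm t' t] at e2
    have e3 := C.P_sub e1 e2
    have e4 : g ^ u • g ^ t • y - g ^ (t + u) • (y - v) = 0 := by
      rw [smul_sub, smul_smul, pow_add g t u, mul_smul _ _ v, hu, smul_zero, mul_comm, sub_zero, sub_self]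
    rw [e4] at e3
    obtain ⟨w, hw⟩ := ih e3 (zero_mem _)
    have hw2 := LCRes.pow_mono u hw
    refine ⟨w + t' + u, ?_⟩
    rw [List.map_cons, Ideal.ofList_cons]
    have e5 : t + t' + w + u = t + (w + t' + u) := by ring
    rw [e5] at hw2
    have : (g :: fs).prod ^ (w + t' + u) * m = g ^ (t + (w + t' + u)) * (fs.prod ^ (u + w + t) * m') +
        g ^ (w + t') * (fs.prod ^ u * (fs.prod ^ w * (g ^ u * (fs.prod ^ t' * m) - g ^ (t + u) * (fs.prod ^ t * m')))) := by
      rw [List.prod_cons]; ring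
    rw [this]
    refine add_mem (Ideal.mem_sup_left ?_) (Ideal.mem_sup_right (Ideal.mul_mem_left _ _ hw2))
    exact Ideal.mul_mem_right _ _ (Ideal.mem_span_singleton_self _)

lemma P_van {t : ℕ} : ∀ {fs : List R} (_ : ∀ f ∈ fs, f ≠ 0) {m : R} {x : C.E fs.length}, C.P t fs m x →
    m ∈ Ideal.ofList (fs.map (· ^ t)) → x ∈ C.B (Ideal.ofList fs) fs.length := by
  intro fs
  induction fs with
  | nil =>
    intro _ m x h hm
    have h1 : x = C.ι m := h
    simp at hm
    rw [h1, hm, map_zero]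
    exact zero_mem _
  | cons g fs ih =>
    rintro hfs m x ⟨y, hy, rfl, h⟩ hm
    have hfs' : ∀ f ∈ fs, f ≠ 0 := fun f hf => hfs f (List.mem_cons_of_mem _ hf)
    have hg : g ≠ 0 := hfs g List.mem_cons_self
    rw [List.map_cons, Ideal.ofList_cons] at hm
    obtain ⟨b, hb, c, hc, rfl⟩ := Submodule.mem_sup.1 hm
    obtain ⟨r, rfl⟩ := Ideal.mem_span_singleton'.1 hb
    obtain ⟨z, hz⟩ := C.P_tot t hfs' r
    have h3 := C.P_sub h (C.P_smul (g ^ t) hz)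
    have e1 : r * g ^ t + c - g ^ t * r = c := by ring
    rw [e1, ← smul_sub] at h3
    obtain ⟨w, hw, hw'⟩ := C.div_B (ih hfs' h3 hc) hg t
    refine ⟨y - z - w, lc_tors_cons.2 ⟨sub_mem (sub_mem hy (C.P_mem hz).1) (C.B_le_T _ _ hw), t, ?_⟩, ?_⟩
    · rw [smul_sub, hw', sub_self]
    · rw [map_sub, map_sub, C.d_B hw, (C.P_mem hz).2, sub_zero, sub_zero]

lemma main_aux {p : ℕ} (hp : 1 < p) {fs : List R} (hfs : ∀ f ∈ fs, f ≠ 0) (M : Ideal R)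
    (frob : ∀ (e : ℕ) (a : R), (∀ r ∈ M, r * a ∈ Ideal.ofList (fs.map (· ^ (p ^ e)))) →
      a ∈ Ideal.ofList (fs.map (· ^ (p ^ e)))) (x : C.E fs.length)
    (hx : x ∈ C.T (Ideal.ofList fs) fs.length) (hdx : C.d _ x = 0)
    (hM : ∀ r ∈ M, r • x ∈ C.B (Ideal.ofList fs) fs.length) : x ∈ C.B (Ideal.ofList fs) fs.length := by
  obtain ⟨t, a, ha⟩ := C.P_surj x hx hdx
  obtain ⟨G, hG⟩ := (isNoetherianRing_iff_ideal_fg R).1 inferInstance M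
  have h1 : ∀ r ∈ M, ∃ u, fs.prod ^ u * (r * a) ∈ Ideal.ofList (fs.map (· ^ (t + u))) :=
    fun r hr => C.P_ker (C.P_smul r ha) (hM r hr)
  choose! u hu using h1
  let U := G.sup u
  let e := t + U
  have he : t + U ≤ p ^ e := (Nat.lt_pow_self hp).le
  have h2 : ∀ r ∈ M, r * (fs.prod ^ (p ^ e - t) * a) ∈ Ideal.ofList (fs.map (· ^ (p ^ e))) := by
    have : M ≤ (Ideal.ofList (fs.map (· ^ (p ^ e)))).colon ({fs.prod ^ (p ^ e - t) * a} : Set R) := by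
      rw [← hG, Ideal.span_le]
      intro r hr
      have hrM : r ∈ M := by rw [← hG]; exact Ideal.subset_span hr
      rw [SetLike.mem_coe, Submodule.mem_colon_singleton]
      have hle : u r ≤ U := Finset.le_sup hr
      have h3 := LCRes.pow_mono (p ^ e - t - u r) (hu r hrM)
      have e1 : t + u r + (p ^ e - t - u r) = p ^ e := by omega
      have e2 : p ^ e - t = (p ^ e - t - u r) + u r := by omega
      rw [e1] at h3
      rw [e2, smul_eq_mul]
      convert h3 using 1
      ring
    intro r hr
    exact Submodule.mem_colon_singleton.1 (this hr)
  have h4 := frob e _ h2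
  exact C.P_van hfs (C.P_compat' (by omega) ha) h4

lemma main {p : ℕ} (hp : 1 < p) {fs : List R} (M : Ideal R)
    (frob : ∀ (e : ℕ) (a : R), (∀ r ∈ M, r * a ∈ Ideal.ofList (fs.map (· ^ (p ^ e)))) →
      a ∈ Ideal.ofList (fs.map (· ^ (p ^ e)))) (x : C.E fs.length)
    (hx : x ∈ C.T (Ideal.ofList fs) fs.length) (hdx : C.d _ x = 0)
    (hM : ∀ r ∈ M, r • x ∈ C.B (Ideal.ofList fs) fs.length) : x ∈ C.B (Ideal.ofList fs) fs.length := by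
  classical
  by_cases hfs : ∀ f ∈ fs, f ≠ 0
  · exact C.main_aux hp hfs M frob x hx hdx hM
  push Not at hfs
  obtain ⟨f, hf, rfl⟩ := hfs
  have h1 : Ideal.ofList (fs.erase 0) = Ideal.ofList fs := by
    apply le_antisymm
    · exact Ideal.span_mono fun x hx => List.mem_of_mem_erase hx
    · refine Ideal.span_le.2 fun x hx => ?_
      by_cases h0 : x = 0
      · rw [h0]; exact zero_mem _
      · exact Ideal.subset_span ((List.mem_erase_of_ne h0).2 hx)
  have h2 := C.van (fs.erase 0) fs.length (by
    rw [List.length_erase_of_mem hf]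
    have := List.length_pos_of_mem hf
    omega) x (by rw [h1]; exact hx) hdx
  rwa [h1] at h2

end LCRes
end B

section C

/-- A weak form of freeness of a ring homomorphism. -/
def LCW {R S : Type} [CommRing R] [CommRing S] (φ : R →+* S) : Prop :=
  ∃ (J : Type) (π : J → S →+ R), (∀ j c a, π j (φ c * a) = c * π j a) ∧
    ∀ a, a ∈ Ideal.span (Set.range fun j => φ (π j a))

lemma LCW.comp {R S T : Type} [CommRing R] [CommRing S] [CommRing T] {φ : R →+* S} {ψ : S →+* T}
    (h : LCW φ) (h' : LCW ψ) : LCW (ψ.comp φ) := by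
  obtain ⟨J, π, h1, h2⟩ := h
  obtain ⟨J', π', h1', h2'⟩ := h'
  refine ⟨J × J', fun j => (π j.1).comp (π' j.2), ?_, ?_⟩
  · intro j c a
    simp [h1, h1']
  · intro a
    refine Ideal.span_le.2 ?_ (h2' a)
    rintro _ ⟨j', rfl⟩
    have := Ideal.mem_map_of_mem ψ (h2 (π' j' a))
    rw [Ideal.map_span] at this
    refine Ideal.span_mono ?_ this
    rintro _ ⟨_, ⟨j, rfl⟩, rfl⟩
    exact ⟨(j, j'), rfl⟩

lemma LCW.colon {R S : Type} [CommRing R] [CommRing S] {φ : R →+* S} (h : LCW φ) (I M : Ideal R)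
    (hM : ∀ c, (∀ r ∈ M, r * c ∈ I) → c ∈ I) (a : S) (ha : ∀ r ∈ M, φ r * a ∈ I.map φ) :
    a ∈ I.map φ := by
  obtain ⟨J, π, h1, h2⟩ := h
  have h3 : ∀ j, ∀ b ∈ I.map φ, π j b ∈ I := by
    intro j b hb
    refine Submodule.span_induction (p := fun b _ => ∀ c, π j (c * b) ∈ I) ?_ ?_ ?_ ?_ hb 1 |> fun h => by simpa using h
    · rintro _ ⟨i, hi, rfl⟩ c
      rw [mul_comm, h1]
      exact Ideal.mul_mem_right _ _ hi
    · simp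
    · intro x y _ _ hx hy c
      rw [mul_add, map_add]
      exact add_mem (hx c) (hy c)
    · intro r x _ hx c
      rw [smul_eq_mul, ← mul_assoc]
      exact hx _
  refine Ideal.span_le.2 ?_ (h2 a)
  rintro _ ⟨j, rfl⟩
  apply Ideal.mem_map_of_mem
  apply hM
  intro r hr
  rw [← h1]
  exact h3 j _ (ha r hr)

open MvPolynomial in
lemma lcw_map {σ k K : Type} [Field k] [Field K] (φ : k →+* K) : LCW (MvPolynomial.map φ : MvPolynomial σ k →+* MvPolynomial σ K) := by
  classical
  let _ := φ.toAlgebra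
  let b := Module.Basis.ofVectorSpace k K
  have hc : ∀ (l : K →ₗ[k] k) (a : MvPolynomial σ K) (α : σ →₀ ℕ),
      coeff α (∑ β ∈ a.support, monomial β (l (coeff β a))) = l (coeff α a) := by
    intro l a α
    rw [coeff_sum]
    simp only [coeff_monomial]
    rw [Finset.sum_ite_eq' a.support α]
    split_ifs with h
    · rfl
    · rw [notMem_support_iff.1 h, map_zero]
  let PP : (K →ₗ[k] k) → (MvPolynomial σ K →+ MvPolynomial σ k) := fun l =>
    { toFun := fun a => ∑ β ∈ a.support, monomial β (l (coeff β a))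
      map_zero' := by simp
      map_add' := by
        intro a b
        ext α
        rw [coeff_add, hc, hc, hc, coeff_add, map_add] }
  have hc' : ∀ l a α, coeff α (PP l a) = l (coeff α a) := hc
  refine ⟨_, fun j => PP (b.coord j), ?_, ?_⟩
  · intro j c a
    ext α
    rw [hc', coeff_mul, coeff_mul, map_sum]
    refine Finset.sum_congr rfl fun x _ => ?_
    rw [hc', coeff_map]
    exact map_smul (b.coord j) (coeff x.1 c) (coeff x.2 a)
  · intro a
    let S := a.support.biUnion fun α => (b.repr (coeff α a)).support
    have : a = ∑ j ∈ S, C (b j) * map φ (PP (b.coord j) a) := by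
      ext α
      rw [coeff_sum]
      simp only [coeff_C_mul, coeff_map, hc']
      have h1 := b.linearCombination_repr (coeff α a)
      rw [Finsupp.linearCombination_apply, Finsupp.sum_of_support_subset (s := S)] at h1
      · refine h1.symm.trans (Finset.sum_congr rfl fun j _ => ?_)
        rw [mul_comm]
        rfl
      · by_cases hα : α ∈ a.support
        · exact Finset.subset_biUnion_of_mem (fun α => (b.repr (coeff α a)).support) hα
        · rw [notMem_support_iff.1 hα]
          simp
      · simp
    have h2 : ∑ j ∈ S, C (b j) * map φ (PP (b.coord j) a) ∈ Ideal.span (Set.range fun j => map φ (PP (b.coord j) a)) := 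
      sum_mem fun j _ => Ideal.mul_mem_left _ _ (Ideal.subset_span ⟨j, rfl⟩)
    rwa [← this] at h2

open MvPolynomial in
lemma lcw_expand {n : ℕ} {K : Type} [Field K] (q : ℕ) (hq : 0 < q) :
    LCW ((expand q : MvPolynomial (Fin n) K →ₐ[K] MvPolynomial (Fin n) K) : MvPolynomial (Fin n) K →+* MvPolynomial (Fin n) K) := by
  classical
  let md : (Fin n →₀ ℕ) → (Fin n →₀ ℕ) := fun α => α.mapRange (· % q) (by simp)
  let dv : (Fin n →₀ ℕ) → (Fin n →₀ ℕ) := fun α => α.mapRange (· / q) (by simp)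
  have amd : ∀ α i, md α i = α i % q := fun _ _ => rfl
  have adv : ∀ α i, dv α i = α i / q := fun _ _ => rfl
  let PP : (Fin n →₀ ℕ) → (MvPolynomial (Fin n) K →ₗ[K] MvPolynomial (Fin n) K) := fun β =>
    (basisMonomials (Fin n) K).constr K (fun α => if md α = β then monomial (dv α) 1 else 0)
  have hPP : ∀ β α s, PP β (monomial α s) = if md α = β then monomial (dv α) s else 0 := by
    intro β α s
    have h1 : monomial α s = s • basisMonomials (Fin n) K α := by
      simp [smul_monomial]
    rw [h1, map_smul, Module.Basis.constr_basis]
    split_ifs <;> simp [smul_monomial]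
  have hmd : ∀ u α, md (q • u + α) = md α := by
    intro u α
    ext i
    simp [amd]
  have hdv : ∀ u α, dv (q • u + α) = u + dv α := by
    intro u α
    ext i
    simp [adv, Nat.mul_add_div hq]
  have hdm : ∀ α, md α + q • dv α = α := by
    intro α
    ext i
    simp [amd, adv, Nat.mod_add_div]
  refine ⟨_, fun β => (PP β).toAddMonoidHom, ?_, ?_⟩
  · intro β c a
    change PP β (expand q c * a) = c * PP β a
    induction c using MvPolynomial.induction_on' with
    | add c c' h h' => rw [map_add, add_mul, map_add, h, h', add_mul]
    | monomial u s =>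
      induction a using MvPolynomial.induction_on' with
      | add a a' h h' => rw [mul_add, map_add, h, h', map_add, mul_add]
      | monomial v s' =>
        rw [expand_monomial, monomial_mul, hPP, hPP, hmd, hdv]
        split_ifs <;> simp [monomial_mul]
  · intro a
    let S : Finset (Fin n →₀ ℕ) := Finset.Iic (Finsupp.equivFunOnFinite.symm fun _ => q)
    have : ∀ a, ∑ β ∈ S, monomial β (1 : K) * expand q (PP β a) = a := by
      intro a
      induction a using MvPolynomial.induction_on' with
      | add a a' h h' =>
        simp only [map_add, mul_add, Finset.sum_add_distrib, h, h']
      | monomial α s =>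
        rw [Finset.sum_eq_single (md α)]
        · rw [hPP, if_pos rfl, expand_monomial, monomial_mul, hdm, one_mul]
        · intro β _ hβ
          rw [hPP, if_neg hβ.symm, map_zero, mul_zero]
        · intro h
          exfalso
          apply h
          rw [Finset.mem_Iic]
          intro i
          rw [amd]
          exact (Nat.mod_lt _ hq).le
    have h2 : ∑ β ∈ S, monomial β (1 : K) * expand q (PP β a) ∈ Ideal.span (Set.range fun β => expand q (PP β a)) := 
      sum_mem fun j _ => Ideal.mul_mem_left _ _ (Ideal.subset_span ⟨j, rfl⟩)
    rw [this] at h2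
    exact h2

open MvPolynomial in
lemma lc_frob (p : ℕ) (hp : p.Prime) (k : Type) [Field k] [CharP k p] (n : ℕ)
    (fs : List (MvPolynomial (Fin n) k)) (M : Ideal (MvPolynomial (Fin n) k))
    (hM : ∀ c, (∀ r ∈ M, r * c ∈ Ideal.ofList fs) → c ∈ Ideal.ofList fs) (e : ℕ) (a : MvPolynomial (Fin n) k)
    (ha : ∀ r ∈ M, r * a ∈ Ideal.ofList (fs.map (· ^ (p ^ e)))) :
      a ∈ Ideal.ofList (fs.map (· ^ (p ^ e))) := by
  have := Fact.mk hp
  have : ExpChar k p := ExpChar.prime hp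
  have hq : 0 < p ^ e := pow_pos hp.pos e
  have hW := (lcw_expand (n := n) (K := k) (p ^ e) hq).comp (lcw_map (σ := Fin n) (iterateFrobenius k p e))
  have hφ : ∀ c, ((MvPolynomial.map (iterateFrobenius k p e)).comp
     ((expand (p ^ e) : MvPolynomial (Fin n) k →ₐ[k] MvPolynomial (Fin n) k) : MvPolynomial (Fin n) k →+* MvPolynomial (Fin n) k)) c = c ^ (p ^ e) :=
    fun c => map_iterateFrobenius_expand p c e
  have hmap : Ideal.ofList (fs.map (· ^ (p ^ e))) = (Ideal.ofList fs).map ((MvPolynomial.map (iterateFrobenius k p e)).comp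
     ((expand (p ^ e) : MvPolynomial (Fin n) k →ₐ[k] MvPolynomial (Fin n) k) : MvPolynomial (Fin n) k →+* MvPolynomial (Fin n) k)) := by
    rw [Ideal.map_ofList]
    congr 2
    funext c
    exact (hφ c).symm
  rw [hmap] at ha ⊢
  refine hW.colon _ M hM a fun r hr => ?_
  have hr2 : r ^ (p ^ e) * a = r ^ (p ^ e - 1) * (r * a) := by
    rw [← mul_assoc, ← pow_succ, Nat.sub_add_cancel hq]
  rw [hφ, hr2]
  exact Ideal.mul_mem_left _ _ (ha r hr)

end C

section D
open CategoryTheory Limits Opposite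
variable {R : Type} [CommRing R]

/-- The elementary data extracted from an injective resolution. -/
noncomputable def lcOf (E : InjectiveResolution (ModuleCat.of R R)) : LCRes R where
  E i := E.cocomplex.X i
  d i := (E.cocomplex.d i (i+1)).hom
  ι := (E.ι.f 0).hom
  ι_inj := by
    intro m hm
    have h : Function.Injective (E.ι.f 0).hom := (ModuleCat.mono_iff_injective _).1 inferInstance
    exact h (hm.trans (map_zero _).symm)
  d_ι := by
    intro m
    exact congrArg (fun k => k.hom m) E.ι_f_zero_comp_complex_d
  d_d := by
    intro i x
    exact congrArg (fun k => k.hom x) (E.cocomplex.d_comp_d i (i+1) (i+2))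
  exact_zero := by
    intro x hx
    exact (ShortComplex.moduleCat_exact_iff _).1 E.exact₀ x hx
  exact_succ := by
    intro i x hx
    exact (ShortComplex.moduleCat_exact_iff _).1 (E.exact_succ i) x hx
  baer := by
    intro i
    have hinj : Injective (ModuleCat.of R (E.cocomplex.X i)) := E.injective i
    have := Module.injective_module_of_injective_object R (E.cocomplex.X i)
    exact Module.Baer.of_injective this

lemma lcOf_mem_B (E : InjectiveResolution (ModuleCat.of R R)) (J : Ideal R) (s : ℕ) (x : E.cocomplex.X s) :
    (x = 0 ∨ ∃ i, i + 1 = s ∧ ∃ y : E.cocomplex.X i,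
        (∃ t : ℕ, ∀ r ∈ J ^ t, r • y = 0) ∧ (E.cocomplex.d i s).hom y = x) ↔ x ∈ (lcOf E).B J s := by
  cases s with
  | zero =>
    constructor
    · rintro (h | ⟨i, hi, _⟩)
      · exact h
      · omega
    · intro h
      exact Or.inl h
  | succ s =>
    constructor
    · rintro (h | ⟨i, hi, y, hy, hy'⟩)
      · rw [h]; exact zero_mem _
      · obtain rfl : i = s := by omega
        exact ⟨y, hy, hy'⟩
    · rintro ⟨y, hy, hy'⟩
      exact Or.inr ⟨s, rfl, y, hy, hy'⟩

lemma lc_final (p : ℕ) (hp : p.Prime) (k : Type) [Field k] [CharP k p]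
    (n : ℕ) (fs : List (MvPolynomial (Fin n) k)) (s : ℕ) (hs : s = fs.length)
    (I : Ideal (MvPolynomial (Fin n) k)) (hI : I = Ideal.ofList fs)
    (m : Ideal (MvPolynomial (Fin n) k))
    (h0 : zerothLocalCohomology m (MvPolynomial (Fin n) k ⧸ I) = ⊥) :
    zerothLocalCohomology m
      ((localCohomology I s).obj
        (ModuleCat.of (MvPolynomial (Fin n) k) (MvPolynomial (Fin n) k))) = ⊥ := by
  subst hs hI
  rw [eq_bot_iff]
  rintro ξ ⟨N, hN⟩
  rw [Submodule.mem_bot]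
  let E := injectiveResolution (ModuleCat.of (MvPolynomial (Fin n) k) (MvPolynomial (Fin n) k))
  obtain ⟨x, hdx, hx, hr⟩ := lcA (Ideal.ofList fs) fs.length _ E ξ
  have hr' : ∀ r : MvPolynomial (Fin n) k, r • ξ = 0 ↔ r • x ∈ (lcOf E).B (Ideal.ofList fs) fs.length :=
    fun r => (hr r).trans (lcOf_mem_B E _ _ (r • x))
  have hM : ∀ c, (∀ r ∈ m ^ N, r * c ∈ Ideal.ofList fs) → c ∈ Ideal.ofList fs := by
    intro c hc
    have h1 : (Ideal.Quotient.mk (Ideal.ofList fs) c) ∈ zerothLocalCohomology m (MvPolynomial (Fin n) k ⧸ Ideal.ofList fs) := by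
      refine ⟨N, fun r hr => ?_⟩
      exact Ideal.Quotient.eq_zero_iff_mem.2 (hc r hr)
    rw [h0, Submodule.mem_bot] at h1
    exact Ideal.Quotient.eq_zero_iff_mem.1 h1
  have hxB := (lcOf E).main hp.one_lt (m ^ N) (lc_frob p hp k n fs (m ^ N) hM) x hx hdx
    (fun r h => (hr' r).1 (hN r h))
  have h1 := (hr' 1).2 (by rw [one_smul]; exact hxB)
  rwa [one_smul] at h1

end D

/-- Let `k` be a field of characteristic `p > 0`, let `R = k[x₁,…,xₙ]`, let
`I = (f₁,…,f_s)` be an ideal of `R` and let `m` be a maximal ideal of `R`.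
If `H⁰_m(R/I) = 0`, then `H⁰_m(H^s_I(R)) = 0`, where `s` is the number of
generators of `I`. -/
theorem zerothLocalCohomology_top_localCohomology_eq_bot
    (p : ℕ) (hp : p.Prime) (k : Type) [Field k] [CharP k p]
    (n s : ℕ) (f : Fin s → MvPolynomial (Fin n) k)
    (m : Ideal (MvPolynomial (Fin n) k)) (hm : m.IsMaximal)
    (h0 : zerothLocalCohomology m
      (MvPolynomial (Fin n) k ⧸ Ideal.span (Set.range f)) = ⊥) :
    zerothLocalCohomology m
      ((localCohomology (Ideal.span (Set.range f)) s).obj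
        (ModuleCat.of (MvPolynomial (Fin n) k) (MvPolynomial (Fin n) k))) = ⊥ := by
  refine lc_final p hp k n (List.ofFn f) s (by simp) _ ?_ m h0
  congr 1
  ext x
  simp [List.mem_ofFn]
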